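/- Let d ≥ 3, let (F1,F2,F3) be a triple of complete flags of ℂ^d in general position, let j = (j1,j2,j3) ∈ B, and let z be a nonzero complex number. Then ℂ^d = F2^{j2} ⊕ (F1^{j1} + F3^{j3}), so there is a unique a ∈ GL_d(ℂ) acting as multiplication by z on F2^{j2} and as the identity on F1^{j1} + F3^{j3}. For this a, the triple (F1, F2, a·F3) is in general position, T^j(F1,F2,a·F3) = z·T^j(F1,F2,F3), and T^k(F1,F2,a·F3) = T^k(F1,F2,F3) for every k ∈ B with k ≠ j. -/

import Mathlib

noncomputable section

/-- A complete flag of `ℂ^d`: an increasing chain of subspaces `F 0 ⊆ F 1 ⊆ ⋯` of `ℂ^d`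
with `dim (F k) = k` for all `k ≤ d`. -/
def IsCompleteFlag (d : ℕ) (F : ℕ → Submodule ℂ (Fin d → ℂ)) : Prop :=
  Monotone F ∧ ∀ k, k ≤ d → Module.finrank ℂ ↥(F k) = k

/-- Two complete flags of `ℂ^d` are transverse: `F^k + G^(d-k) = ℂ^d` for all `k`. -/
def TransverseFlags (d : ℕ) (F G : ℕ → Submodule ℂ (Fin d → ℂ)) : Prop :=
  ∀ k, k ≤ d → F k ⊔ G (d - k) = ⊤

/-- The flag `g · F`, whose subspaces are the images `g (F k)`. -/
def flagMap (d : ℕ) (g : Matrix (Fin d) (Fin d) ℂ) (F : ℕ → Submodule ℂ (Fin d → ℂ)) :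
    ℕ → Submodule ℂ (Fin d → ℂ) :=
  fun k => Submodule.map g.mulVecLin (F k)

/-- A triple of flags of `ℂ^d` in general position:
`F1^k1 + F2^k2 + F3^k3 = ℂ^d` whenever `k1 + k2 + k3 = d`. -/
def GenPos3 (d : ℕ) (F1 F2 F3 : ℕ → Submodule ℂ (Fin d → ℂ)) : Prop :=
  ∀ k1 k2 k3 : ℕ, k1 + k2 + k3 = d → F1 k1 ⊔ F2 k2 ⊔ F3 k3 = ⊤

/-- The index set `B`: triples of positive integers summing to `d`. -/
def memB (d : ℕ) (j : ℕ × ℕ × ℕ) : Prop :=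
  0 < j.1 ∧ 0 < j.2.1 ∧ 0 < j.2.2 ∧ j.1 + j.2.1 + j.2.2 = d

/-- The index set `A`: pairs of positive integers summing to `d`. -/
def memA (d : ℕ) (i : ℕ × ℕ) : Prop :=
  0 < i.1 ∧ 0 < i.2 ∧ i.1 + i.2 = d

/-- `v 0, v 1, …, v (d-1)` is a basis adapted to the flag `F`: for every `k ≤ d`, the
subspace `F k` is spanned by the first `k` vectors.  A nonzero element `f^k` of the line
`⋀^k F^k` is then given by `v 0 ∧ ⋯ ∧ v (k-1)`. -/
def IsAdaptedBasis (d : ℕ) (F : ℕ → Submodule ℂ (Fin d → ℂ)) (v : ℕ → Fin d → ℂ) : Prop :=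
  ∀ k, k ≤ d → F k = Submodule.span ℂ (v '' {m | m < k})

/-- A choice of adapted basis for a flag. -/
noncomputable def flagBasis (d : ℕ) (F : ℕ → Submodule ℂ (Fin d → ℂ)) : ℕ → Fin d → ℂ :=
  Classical.epsilon (IsAdaptedBasis d F)

/-- The scalar `f1^a ∧ f2^b ∧ f3^(d-a-b)`: the wedge product of the first `a` vectors of
`v1`, the first `b` vectors of `v2` and the first `d - a - b` vectors of `v3`, viewed as a
complex number via the determinant (i.e. via the standard identification `⋀^d ℂ^d ≅ ℂ`). -/
noncomputable def wedgeDet (d a b : ℕ) (v1 v2 v3 : ℕ → Fin d → ℂ) : ℂ :=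
  Matrix.det (Matrix.of fun (i j : Fin d) =>
    if (i : ℕ) < a then v1 (i : ℕ) j
    else if (i : ℕ) < a + b then v2 ((i : ℕ) - a) j
    else v3 ((i : ℕ) - a - b) j)

/-- The triple ratio `T^j(F1,F2,F3)` of a triple of flags in general position,
for `j = (j1,j2,j3)` with `j1 + j2 + j3 = d`. -/
noncomputable def tripleRatio (d : ℕ) (j : ℕ × ℕ × ℕ)
    (F1 F2 F3 : ℕ → Submodule ℂ (Fin d → ℂ)) : ℂ :=
  (wedgeDet d (j.1 + 1) j.2.1 (flagBasis d F1) (flagBasis d F2) (flagBasis d F3) *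
      wedgeDet d j.1 (j.2.1 - 1) (flagBasis d F1) (flagBasis d F2) (flagBasis d F3) *
      wedgeDet d (j.1 - 1) (j.2.1 + 1) (flagBasis d F1) (flagBasis d F2) (flagBasis d F3)) /
    (wedgeDet d (j.1 - 1) j.2.1 (flagBasis d F1) (flagBasis d F2) (flagBasis d F3) *
      wedgeDet d j.1 (j.2.1 + 1) (flagBasis d F1) (flagBasis d F2) (flagBasis d F3) *
      wedgeDet d (j.1 + 1) (j.2.1 - 1) (flagBasis d F1) (flagBasis d F2) (flagBasis d F3))

/-- A choice of nonzero vector in a (1-dimensional) subspace. -/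
noncomputable def lineVec (d : ℕ) (l : Submodule ℂ (Fin d → ℂ)) : Fin d → ℂ :=
  Classical.epsilon fun v => v ∈ l ∧ v ≠ 0

/-- The double ratio `D^i(G1,G2,ℓ1,ℓ2)` of a pair of transverse flags and a pair of lines,
for `i = (i1,i2)` with `i1 + i2 = d`. -/
noncomputable def doubleRatioLine (d : ℕ) (i : ℕ × ℕ) (G1 G2 : ℕ → Submodule ℂ (Fin d → ℂ))
    (l1 l2 : Submodule ℂ (Fin d → ℂ)) : ℂ :=
  -((wedgeDet d i.1 (i.2 - 1) (flagBasis d G1) (flagBasis d G2) (fun _ => lineVec d l1) *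
        wedgeDet d (i.1 - 1) i.2 (flagBasis d G1) (flagBasis d G2) (fun _ => lineVec d l2)) /
      (wedgeDet d i.1 (i.2 - 1) (flagBasis d G1) (flagBasis d G2) (fun _ => lineVec d l2) *
        wedgeDet d (i.1 - 1) i.2 (flagBasis d G1) (flagBasis d G2) (fun _ => lineVec d l1)))

/-- The double ratio `D^i(G1,G2,H1,H2)` of four flags, which only depends on the
`1`-dimensional parts of `H1` and `H2`. -/
noncomputable def doubleRatio (d : ℕ) (i : ℕ × ℕ)
    (G1 G2 H1 H2 : ℕ → Submodule ℂ (Fin d → ℂ)) : ℂ :=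
  doubleRatioLine d i G1 G2 (H1 1) (H2 1)

/-- The rows of the matrix in `wedgeDet`. -/
def wrow (d a b : ℕ) (v1 v2 v3 : ℕ → Fin d → ℂ) (i : ℕ) : Fin d → ℂ :=
  if i < a then v1 i else if i < a + b then v2 (i - a) else v3 (i - a - b)

lemma wedgeDet_eq (d a b : ℕ) (v1 v2 v3 : ℕ → Fin d → ℂ) :
    wedgeDet d a b v1 v2 v3 = Matrix.det (Matrix.of fun i : Fin d => wrow d a b v1 v2 v3 i) := by
  unfold wedgeDet wrow
  congr 1
  ext i j
  simp only [Matrix.of_apply]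
  split_ifs <;> rfl

lemma det_tri {d : ℕ} (r r' : Fin d → Fin d → ℂ) (c : Fin d → ℂ)
    (h : ∀ i, r' i - c i • r i ∈ Submodule.span ℂ (r '' {l | l < i})) :
    Matrix.det (Matrix.of r') = (∏ i, c i) * Matrix.det (Matrix.of r) := by
  have h' : ∀ i, ∃ t : Fin d → ℂ, (∀ l, ¬ l < i → t l = 0) ∧
      r' i - c i • r i = ∑ l, t l • r l := by
    intro i
    refine Submodule.span_induction (p := fun y _ => ∃ t : Fin d → ℂ,
      (∀ l, ¬ l < i → t l = 0) ∧ y = ∑ l, t l • r l) ?_ ?_ ?_ ?_ (h i)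
    · rintro _ ⟨l, hl, rfl⟩
      refine ⟨Pi.single l 1, ?_, ?_⟩
      · intro m hm
        have : m ≠ l := by rintro rfl; exact hm hl
        simp [this]
      · rw [Finset.sum_eq_single l] <;> simp +contextual
    · exact ⟨0, by simp, by simp⟩
    · rintro _ _ _ _ ⟨s, hs, rfl⟩ ⟨t, ht, rfl⟩
      refine ⟨s + t, fun l hl => by simp [hs l hl, ht l hl], ?_⟩
      simp [add_smul, Finset.sum_add_distrib]
    · rintro k _ _ ⟨s, hs, rfl⟩
      refine ⟨k • s, fun l hl => by simp [hs l hl], ?_⟩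
      simp [mul_smul, Finset.smul_sum]
  choose t ht0 ht using h'
  let T : Matrix (Fin d) (Fin d) ℂ := Matrix.diagonal c + Matrix.of t
  have hT : Matrix.of r' = T * Matrix.of r := by
    ext i j
    have := congrFun (ht i) j
    simp only [Pi.sub_apply, Pi.smul_apply, Finset.sum_apply, smul_eq_mul] at this
    simp only [T, Matrix.add_mul, Matrix.add_apply, Matrix.diagonal_mul, Matrix.of_apply]
    rw [Matrix.mul_apply]
    simp only [Matrix.of_apply]
    rw [← this]; ring
  rw [hT, Matrix.det_mul, Matrix.det_of_lowerTriangular]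
  · congr 1
    refine Finset.prod_congr rfl fun i _ => ?_
    simp [T, ht0 i i]
  · intro i l hil
    have h1 : i < l := hil
    simp [T, ht0 i l (not_lt.mpr h1.le), h1.ne]

lemma prod_fin_blocks (d k1 k2 k3 : ℕ) (hk : k1 + k2 + k3 = d) (c1 c2 c3 : ℕ → ℂ) :
    (∏ i : Fin d, (if (i : ℕ) < k1 then c1 i else if (i : ℕ) < k1 + k2 then c2 (i - k1)
      else c3 (i - k1 - k2))) =
    (∏ m ∈ Finset.range k1, c1 m) * (∏ m ∈ Finset.range k2, c2 m) *
      (∏ m ∈ Finset.range k3, c3 m) := by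
  rw [Fin.prod_univ_eq_prod_range (fun i => if i < k1 then c1 i else if i < k1 + k2 then
    c2 (i - k1) else c3 (i - k1 - k2)) d, ← hk, Finset.prod_range_add, Finset.prod_range_add]
  congr 1
  · congr 1
    · refine Finset.prod_congr rfl fun i hi => ?_
      simp [Finset.mem_range.mp hi]
    · refine Finset.prod_congr rfl fun i hi => ?_
      simp [Finset.mem_range.mp hi]
  · refine Finset.prod_congr rfl fun i hi => ?_
    rw [if_neg (by omega), if_neg (by omega)]
    congr 1; omega

lemma wedge_third (d k1 k2 k3 : ℕ) (hk : k1 + k2 + k3 = d) (v1 v2 v3 w3 : ℕ → Fin d → ℂ)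
    (c : ℕ → ℂ)
    (h : ∀ m < k3, w3 m - c m • v3 m ∈ Submodule.span ℂ (v1 '' {l | l < k1}) ⊔
      Submodule.span ℂ (v2 '' {l | l < k2}) ⊔ Submodule.span ℂ (v3 '' {l | l < m})) :
    wedgeDet d k1 k2 v1 v2 w3 =
      (∏ m ∈ Finset.range k3, c m) * wedgeDet d k1 k2 v1 v2 v3 := by
  rw [wedgeDet_eq, wedgeDet_eq]
  rw [det_tri (fun i : Fin d => wrow d k1 k2 v1 v2 v3 i) _
    (fun i : Fin d => if (i : ℕ) < k1 then (fun _ => 1 : ℕ → ℂ) i else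
      if (i : ℕ) < k1 + k2 then (fun _ => 1 : ℕ → ℂ) (i - k1) else c (i - k1 - k2)),
    prod_fin_blocks d k1 k2 k3 hk (fun _ => 1) (fun _ => 1) c]
  · simp
  · intro i
    by_cases h1 : (i : ℕ) < k1
    · simp [wrow, h1]
    by_cases h2 : (i : ℕ) < k1 + k2
    · simp [wrow, h1, h2]
    simp only [wrow, h1, h2, if_false]
    have hi := i.2
    refine SetLike.le_def.mp ?_ (h (i - k1 - k2) (by omega))
    refine sup_le (sup_le ?_ ?_) ?_
    · refine Submodule.span_mono ?_
      rintro _ ⟨l, hl, rfl⟩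
      have hl : l < k1 := hl
      refine ⟨⟨l, by omega⟩, ?_, by simp [hl]⟩
      change l < i; omega
    · refine Submodule.span_mono ?_
      rintro _ ⟨l, hl, rfl⟩
      have hl : l < k2 := hl
      refine ⟨⟨k1 + l, by omega⟩, ?_, by simp [hl]⟩
      change k1 + l < i; omega
    · refine Submodule.span_mono ?_
      rintro _ ⟨l, hl, rfl⟩
      have hl : l < i - k1 - k2 := hl
      refine ⟨⟨k1 + k2 + l, by omega⟩, ?_, ?_⟩
      · change k1 + k2 + l < i; omega
      · simp only
        rw [if_neg (by omega), if_neg (by omega)]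
        congr 1; omega

lemma wedge_scale (d k1 k2 k3 : ℕ) (hk : k1 + k2 + k3 = d) (v1 v2 v3 w1 w2 w3 : ℕ → Fin d → ℂ)
    (z : ℂ) (h1 : ∀ m < k1, w1 m = v1 m) (h2 : ∀ m < k2, w2 m = z • v2 m)
    (h3 : ∀ m < k3, w3 m = v3 m) :
    wedgeDet d k1 k2 w1 w2 w3 = z ^ k2 * wedgeDet d k1 k2 v1 v2 v3 := by
  rw [wedgeDet_eq, wedgeDet_eq]
  rw [det_tri (fun i : Fin d => wrow d k1 k2 v1 v2 v3 i) _
    (fun i : Fin d => if (i : ℕ) < k1 then (fun _ => 1 : ℕ → ℂ) i else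
      if (i : ℕ) < k1 + k2 then (fun _ => z : ℕ → ℂ) (i - k1) else
        (fun _ => 1 : ℕ → ℂ) (i - k1 - k2)),
    prod_fin_blocks d k1 k2 k3 hk (fun _ => 1) (fun _ => z) (fun _ => 1)]
  · simp
  · intro i
    have hi := i.2
    by_cases h1' : (i : ℕ) < k1
    · simp [wrow, h1', h1 i h1']
    by_cases h2' : (i : ℕ) < k1 + k2
    · simp [wrow, h1', h2', h2 (i - k1) (by omega)]
    simp [wrow, h1', h2', h3 (i - k1 - k2) (by omega)]

lemma wedge_mul (d k1 k2 : ℕ) (v1 v2 v3 : ℕ → Fin d → ℂ) (a : Matrix (Fin d) (Fin d) ℂ) :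
    wedgeDet d k1 k2 (fun m => a.mulVec (v1 m)) (fun m => a.mulVec (v2 m))
      (fun m => a.mulVec (v3 m)) = a.det * wedgeDet d k1 k2 v1 v2 v3 := by
  rw [wedgeDet_eq, wedgeDet_eq, mul_comm, ← Matrix.det_transpose a, ← Matrix.det_mul]
  congr 1
  ext i j
  have : wrow d k1 k2 (fun m => a.mulVec (v1 m)) (fun m => a.mulVec (v2 m))
      (fun m => a.mulVec (v3 m)) i = a.mulVec (wrow d k1 k2 v1 v2 v3 i) := by
    unfold wrow; split_ifs <;> rfl
  simp only [Matrix.of_apply, this, Matrix.mul_apply, Matrix.transpose_apply, Matrix.mulVec,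
    dotProduct]
  exact Finset.sum_congr rfl fun _ _ => mul_comm _ _

lemma wedge_ne_zero_iff (d k1 k2 k3 : ℕ) (hk : k1 + k2 + k3 = d) (v1 v2 v3 : ℕ → Fin d → ℂ) :
    wedgeDet d k1 k2 v1 v2 v3 ≠ 0 ↔ Submodule.span ℂ (v1 '' {l | l < k1}) ⊔
      Submodule.span ℂ (v2 '' {l | l < k2}) ⊔ Submodule.span ℂ (v3 '' {l | l < k3}) = ⊤ := by
  have hs : Submodule.span ℂ (v1 '' {l | l < k1}) ⊔
      Submodule.span ℂ (v2 '' {l | l < k2}) ⊔ Submodule.span ℂ (v3 '' {l | l < k3}) =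
      Submodule.span ℂ (Set.range fun i : Fin d => wrow d k1 k2 v1 v2 v3 i) := by
    rw [← Submodule.span_union, ← Submodule.span_union]
    congr 1
    ext x
    constructor
    · rintro ((⟨l, hl, rfl⟩ | ⟨l, hl, rfl⟩) | ⟨l, hl, rfl⟩)
      · have hl : l < k1 := hl
        exact ⟨⟨l, by omega⟩, by simp [wrow, hl]⟩
      · have hl : l < k2 := hl
        exact ⟨⟨k1 + l, by omega⟩, by simp [wrow, hl]⟩
      · have hl : l < k3 := hl
        refine ⟨⟨k1 + k2 + l, by omega⟩, ?_⟩
        simp only [wrow]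
        rw [if_neg (by omega), if_neg (by omega)]
        congr 1; omega
    · rintro ⟨i, rfl⟩
      have hi := i.2
      simp only [wrow]
      split_ifs with h1 h2
      · exact Or.inl (Or.inl ⟨i, h1, rfl⟩)
      · exact Or.inl (Or.inr ⟨i - k1, by simp only [Set.mem_setOf_eq]; omega, rfl⟩)
      · exact Or.inr ⟨i - k1 - k2, by simp only [Set.mem_setOf_eq]; omega, rfl⟩
  rw [hs, wedgeDet_eq, ← isUnit_iff_ne_zero, ← Matrix.isUnit_iff_isUnit_det,
    ← Matrix.linearIndependent_rows_iff_isUnit]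
  constructor
  · intro h
    exact h.span_eq_top_of_card_eq_finrank' (by simp)
  · intro h
    exact linearIndependent_of_top_le_span_of_card_eq_finrank h.ge (by simp)

lemma exists_adapted (d : ℕ) (F : ℕ → Submodule ℂ (Fin d → ℂ)) (h : IsCompleteFlag d F) :
    ∃ v, IsAdaptedBasis d F v := by
  obtain ⟨hm, hd⟩ := h
  have : ∀ k, ∃ v, k < d → v ∈ F (k + 1) ∧ v ∉ F k := by
    intro k
    by_cases hk : k < d
    · have hlt : F k < F (k + 1) := by
        refine lt_of_le_of_ne (hm (Nat.le_succ k)) fun he => ?_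
        have h1 := hd k hk.le
        have h2 := hd (k + 1) hk
        rw [he] at h1; omega
      obtain ⟨v, h1, h2⟩ := SetLike.exists_of_lt hlt
      exact ⟨v, fun _ => ⟨h1, h2⟩⟩
    · exact ⟨0, fun h => absurd h hk⟩
  choose v hv using this
  refine ⟨v, fun k => ?_⟩
  induction k with
  | zero =>
    intro h0
    have := hd 0 h0
    rw [Submodule.finrank_eq_zero] at this
    simp [this]
  | succ k ih =>
    intro hk
    have ih := ih (by omega)
    have hset : {m | m < k + 1} = insert k {m | m < k} := by
      ext m; simp; omega
    rw [hset, Set.image_insert_eq, Submodule.span_insert, ← ih]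
    obtain ⟨h1, h2⟩ := hv k hk
    symm
    apply Submodule.eq_of_le_of_finrank_le
    · exact sup_le (by simpa using h1) (hm (Nat.le_succ k))
    · rw [hd (k + 1) hk]
      have hlt : F k < Submodule.span ℂ {v k} ⊔ F k := by
        refine lt_of_le_of_ne le_sup_right fun he => h2 ?_
        rw [he]
        exact Submodule.mem_sup_left (Submodule.mem_span_singleton_self _)
      have := Submodule.finrank_lt_finrank_of_lt hlt
      rw [hd k (by omega)] at this
      omega

lemma flagBasis_adapted (d : ℕ) (F : ℕ → Submodule ℂ (Fin d → ℂ)) (h : ∃ v, IsAdaptedBasis d F v) :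
    IsAdaptedBasis d F (flagBasis d F) := Classical.epsilon_spec h

lemma genPos_iff (d : ℕ) (F1 F2 F3 : ℕ → Submodule ℂ (Fin d → ℂ)) (v1 v2 v3 : ℕ → Fin d → ℂ)
    (h1 : IsAdaptedBasis d F1 v1) (h2 : IsAdaptedBasis d F2 v2) (h3 : IsAdaptedBasis d F3 v3) :
    GenPos3 d F1 F2 F3 ↔
      ∀ k1 k2 k3, k1 + k2 + k3 = d → wedgeDet d k1 k2 v1 v2 v3 ≠ 0 := by
  unfold GenPos3
  refine forall_congr' fun k1 => forall_congr' fun k2 => forall_congr' fun k3 =>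
    forall_congr' fun hk => ?_
  rw [wedge_ne_zero_iff d k1 k2 k3 hk, h1 k1 (by omega), h2 k2 (by omega), h3 k3 (by omega)]

lemma adapted_change (d : ℕ) (F : ℕ → Submodule ℂ (Fin d → ℂ)) (v w : ℕ → Fin d → ℂ)
    (hv : IsAdaptedBasis d F v) (hw : IsAdaptedBasis d F w) :
    ∃ c : ℕ → ℂ, ∀ m < d, w m - c m • v m ∈ Submodule.span ℂ (v '' {l | l < m}) := by
  have : ∀ m, ∃ c : ℂ, m < d → w m - c • v m ∈ Submodule.span ℂ (v '' {l | l < m}) := by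
    intro m
    by_cases hm : m < d
    · have h1 : w m ∈ F (m + 1) := by
        rw [hw (m + 1) hm]
        exact Submodule.subset_span ⟨m, by simp, rfl⟩
      have hset : {l | l < m + 1} = insert m {l | l < m} := by
        ext l; simp; omega
      rw [hv (m + 1) hm, hset, Set.image_insert_eq, Submodule.mem_span_insert] at h1
      obtain ⟨c, y, hy, he⟩ := h1
      exact ⟨c, fun _ => by rw [he]; simpa using hy⟩
    · exact ⟨0, fun h => absurd h hm⟩
  choose c hc using this
  exact ⟨c, hc⟩

lemma adapted_map (d : ℕ) (F : ℕ → Submodule ℂ (Fin d → ℂ)) (v : ℕ → Fin d → ℂ)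
    (a : Matrix (Fin d) (Fin d) ℂ) (hv : IsAdaptedBasis d F v) :
    IsAdaptedBasis d (flagMap d a F) (fun m => a.mulVec (v m)) := by
  intro k hk
  rw [flagMap, hv k hk, Submodule.map_span, Set.image_image]
  rfl

lemma exists_mat (d : ℕ) (P Q : Submodule ℂ (Fin d → ℂ)) (h : IsCompl P Q) (z : ℂ) :
    ∃ a : Matrix (Fin d) (Fin d) ℂ, (∀ v ∈ P, a.mulVec v = z • v) ∧ ∀ v ∈ Q, a.mulVec v = v := by
  refine ⟨LinearMap.toMatrix' (LinearMap.ofIsCompl h (z • P.subtype) Q.subtype), ?_, ?_⟩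
  · intro v hv
    rw [LinearMap.toMatrix'_mulVec]
    exact LinearMap.ofIsCompl_left_apply h ⟨v, hv⟩
  · intro v hv
    rw [LinearMap.toMatrix'_mulVec]
    exact LinearMap.ofIsCompl_right_apply h ⟨v, hv⟩

lemma mat_ext (d : ℕ) (P Q : Submodule ℂ (Fin d → ℂ)) (h : IsCompl P Q)
    (a b : Matrix (Fin d) (Fin d) ℂ) (hP : ∀ v ∈ P, a.mulVec v = b.mulVec v)
    (hQ : ∀ v ∈ Q, a.mulVec v = b.mulVec v) : a = b := by
  apply Matrix.mulVec_injective
  funext v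
  have : v ∈ P ⊔ Q := by rw [h.sup_eq_top]; trivial
  obtain ⟨x, hx, y, hy, rfl⟩ := Submodule.mem_sup.mp this
  rw [Matrix.mulVec_add, Matrix.mulVec_add, hP x hx, hQ y hy]

/-- The main computation of wedges. -/
lemma wedge_main (d : ℕ) (F1 F2 F3 : ℕ → Submodule ℂ (Fin d → ℂ)) (v1 v2 v3 : ℕ → Fin d → ℂ)
    (hF1 : Monotone F1) (hF2 : Monotone F2) (hF3 : Monotone F3)
    (h1 : IsAdaptedBasis d F1 v1) (h2 : IsAdaptedBasis d F2 v2) (h3 : IsAdaptedBasis d F3 v3)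
    (hgen : GenPos3 d F1 F2 F3) (j1 j2 j3 : ℕ) (hj : j1 + j2 + j3 = d) (z : ℂ) (hz : z ≠ 0)
    (a : Matrix (Fin d) (Fin d) ℂ)
    (ha2 : ∀ v ∈ F2 j2, a.mulVec v = z • v) (ha13 : ∀ v ∈ F1 j1 ⊔ F3 j3, a.mulVec v = v)
    (k1 k2 k3 : ℕ) (hk : k1 + k2 + k3 = d) :
    wedgeDet d k1 k2 v1 v2 (fun m => a.mulVec (v3 m)) =
      z ^ (min (k3 - j3) (j2 - k2)) * wedgeDet d k1 k2 v1 v2 v3 := by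
  have hmem : ∀ (F : ℕ → Submodule ℂ (Fin d → ℂ)) (v : ℕ → Fin d → ℂ), IsAdaptedBasis d F v →
      ∀ m k, m < k → k ≤ d → v m ∈ F k := by
    intro F v hv m k hm hkd
    rw [hv k hkd]
    exact Submodule.subset_span ⟨m, hm, rfl⟩
  have hsum : ∀ v, ∃ x ∈ F2 j2, ∃ y ∈ F1 j1 ⊔ F3 j3, v = x + y := by
    intro v
    have h := hgen j1 j2 j3 hj
    rw [sup_right_comm] at h
    have : v ∈ F1 j1 ⊔ F3 j3 ⊔ F2 j2 := by rw [h]; trivial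
    obtain ⟨y, hy, x, hx, rfl⟩ := Submodule.mem_sup.mp this
    exact ⟨x, hx, y, hy, add_comm _ _⟩
  have hfix3 : ∀ m < j3, a.mulVec (v3 m) = v3 m := fun m hm =>
    ha13 _ (Submodule.mem_sup_right (hmem F3 v3 h3 m j3 hm (by omega)))
  have hfix1 : ∀ m < j1, a.mulVec (v1 m) = v1 m := fun m hm =>
    ha13 _ (Submodule.mem_sup_left (hmem F1 v1 h1 m j1 hm (by omega)))
  have hfix2 : ∀ m < j2, a.mulVec (v2 m) = z • v2 m := fun m hm =>
    ha2 _ (hmem F2 v2 h2 m j2 hm (by omega))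
  have hsubid : ∀ v, a.mulVec v - v ∈ F2 j2 := by
    intro v
    obtain ⟨x, hx, y, hy, rfl⟩ := hsum v
    rw [Matrix.mulVec_add, ha2 x hx, ha13 y hy]
    have : z • x + y - (x + y) = z • x - x := by abel
    rw [this]
    exact Submodule.sub_mem _ (Submodule.smul_mem _ _ hx) hx
  have hsubz : ∀ v, a.mulVec v - z • v ∈ F1 j1 ⊔ F3 j3 := by
    intro v
    obtain ⟨x, hx, y, hy, rfl⟩ := hsum v
    rw [Matrix.mulVec_add, ha2 x hx, ha13 y hy, smul_add]
    have : z • x + y - (z • x + z • y) = y - z • y := by abel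
    rw [this]
    exact Submodule.sub_mem _ hy (Submodule.smul_mem _ _ hy)
  by_cases c3 : k3 ≤ j3
  · have he : min (k3 - j3) (j2 - k2) = 0 := by omega
    rw [he, wedge_third d k1 k2 k3 hk v1 v2 v3 _ (fun _ => 1)]
    · simp
    · intro m hm
      rw [hfix3 m (by omega)]; simp
  by_cases c2 : j2 ≤ k2
  · have he : min (k3 - j3) (j2 - k2) = 0 := by omega
    rw [he, wedge_third d k1 k2 k3 hk v1 v2 v3 _ (fun _ => 1)]
    · simp
    · intro m hm
      refine Submodule.mem_sup_left (Submodule.mem_sup_right ?_)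
      rw [← h2 k2 (by omega), one_smul]
      exact hF2 c2 (hsubid _)
  by_cases c1 : j1 ≤ k1
  · have he : min (k3 - j3) (j2 - k2) = k3 - j3 := by omega
    rw [he, wedge_third d k1 k2 k3 hk v1 v2 v3 _ (fun m => if m < j3 then 1 else z)]
    · congr 1
      obtain ⟨n, rfl⟩ : ∃ n, k3 = j3 + n := ⟨k3 - j3, by omega⟩
      rw [Finset.prod_range_add, Finset.prod_congr rfl (g := fun _ => (1 : ℂ))]
      · simp
      · intro x hx
        simp [Finset.mem_range.mp hx]
    · intro m hm
      by_cases hm3 : m < j3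
      · simp [hm3, hfix3 m hm3]
      · simp only [hm3, if_false]
        rw [← h1 k1 (by omega), ← h2 k2 (by omega), ← h3 m (by omega)]
        refine SetLike.le_def.mp ?_ (hsubz (v3 m))
        exact sup_le ((hF1 c1).trans (le_sup_left.trans le_sup_left))
          ((hF3 (not_lt.mp hm3)).trans le_sup_right)
  · have he : min (k3 - j3) (j2 - k2) = j2 - k2 := by omega
    have hdet : a.det = z ^ j2 := by
      have hne := (genPos_iff d F1 F2 F3 v1 v2 v3 h1 h2 h3).mp hgen j1 j2 j3 hj
      have e1 := wedge_mul d j1 j2 v1 v2 v3 a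
      rw [wedge_scale d j1 j2 j3 hj v1 v2 v3 _ _ _ z hfix1 hfix2 hfix3] at e1
      exact (mul_right_cancel₀ hne e1).symm
    have e2 := wedge_mul d k1 k2 v1 v2 v3 a
    rw [wedge_scale d k1 k2 k3 hk v1 v2 (fun m => a.mulVec (v3 m)) _ _ _ z
      (fun m hm => hfix1 m (by omega)) (fun m hm => hfix2 m (by omega)) (fun m _ => rfl),
      hdet] at e2
    have hp : z ^ j2 = z ^ k2 * z ^ (j2 - k2) := by rw [← pow_add]; congr 1; omega
    rw [hp, mul_assoc] at e2
    rw [he]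
    exact mul_left_cancel₀ (pow_ne_zero _ hz) e2

theorem statement_7 (d : ℕ) (hd : 3 ≤ d) (F1 F2 F3 : ℕ → Submodule ℂ (Fin d → ℂ))
    (h1 : IsCompleteFlag d F1) (h2 : IsCompleteFlag d F2) (h3 : IsCompleteFlag d F3)
    (hgen : GenPos3 d F1 F2 F3) (j1 j2 j3 : ℕ) (hj : memB d (j1, j2, j3))
    (z : ℂ) (hz : z ≠ 0) :
    -- `ℂ^d = F2^(j2) ⊕ (F1^(j1) + F3^(j3))`
    IsCompl (F2 j2) (F1 j1 ⊔ F3 j3) ∧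
    -- there is a unique `a ∈ GL_d(ℂ)` acting as `z` on `F2^(j2)` and as the identity
    -- on `F1^(j1) + F3^(j3)`
    (∃! a : Matrix (Fin d) (Fin d) ℂ, IsUnit a ∧
        (∀ v ∈ F2 j2, a.mulVec v = z • v) ∧ ∀ v ∈ F1 j1 ⊔ F3 j3, a.mulVec v = v) ∧
    -- and for this `a` the triple ratios transform as claimed
    ∀ a : Matrix (Fin d) (Fin d) ℂ, IsUnit a →
      (∀ v ∈ F2 j2, a.mulVec v = z • v) → (∀ v ∈ F1 j1 ⊔ F3 j3, a.mulVec v = v) →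
      GenPos3 d F1 F2 (flagMap d a F3) ∧
      tripleRatio d (j1, j2, j3) F1 F2 (flagMap d a F3) =
        z * tripleRatio d (j1, j2, j3) F1 F2 F3 ∧
      ∀ k : ℕ × ℕ × ℕ, memB d k → k ≠ (j1, j2, j3) →
        tripleRatio d k F1 F2 (flagMap d a F3) = tripleRatio d k F1 F2 F3 := by
  obtain ⟨hj1, hj2, hj3, hjd⟩ := hj
  simp only at hj1 hj2 hj3 hjd
  have hcompl : IsCompl (F2 j2) (F1 j1 ⊔ F3 j3) := by
    have htop : F2 j2 ⊔ (F1 j1 ⊔ F3 j3) = ⊤ := by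
      have h := hgen j1 j2 j3 hjd
      rw [sup_right_comm, sup_comm] at h
      exact h
    refine ⟨?_, codisjoint_iff.mpr htop⟩
    rw [disjoint_iff, ← Submodule.finrank_eq_zero]
    have e1 := Submodule.finrank_sup_add_finrank_inf_eq (F2 j2) (F1 j1 ⊔ F3 j3)
    have e2 := Submodule.finrank_sup_add_finrank_inf_eq (F1 j1) (F3 j3)
    rw [htop, finrank_top, Module.finrank_fin_fun, h2.2 j2 (by omega)] at e1
    rw [h1.2 j1 (by omega), h3.2 j3 (by omega)] at e2
    omega
  refine ⟨hcompl, ?_, ?_⟩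
  · obtain ⟨a, ha, ha'⟩ := exists_mat d _ _ hcompl z
    obtain ⟨b, hb, hb'⟩ := exists_mat d _ _ hcompl z⁻¹
    refine ⟨a, ⟨?_, ha, ha'⟩, ?_⟩
    · have hab : a * b = 1 := by
        apply mat_ext d _ _ hcompl
        · intro v hv
          rw [← Matrix.mulVec_mulVec, hb v hv, Matrix.mulVec_smul, ha v hv, smul_smul,
            inv_mul_cancel₀ hz, Matrix.one_mulVec, one_smul]
        · intro v hv
          rw [← Matrix.mulVec_mulVec, hb' v hv, ha' v hv, Matrix.one_mulVec]
      exact IsUnit.of_mul_eq_one b hab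
    · rintro c ⟨_, hc, hc'⟩
      apply mat_ext d _ _ hcompl
      · intro v hv; rw [hc v hv, ha v hv]
      · intro v hv; rw [hc' v hv, ha' v hv]
  · intro a _ ha2 ha13
    have A1 := flagBasis_adapted d F1 (exists_adapted d F1 h1)
    have A2 := flagBasis_adapted d F2 (exists_adapted d F2 h2)
    have A3 := flagBasis_adapted d F3 (exists_adapted d F3 h3)
    have A3' := adapted_map d F3 _ a A3
    have A4 := flagBasis_adapted d (flagMap d a F3) ⟨_, A3'⟩
    have hmain := wedge_main d F1 F2 F3 _ _ _ h1.1 h2.1 h3.1 A1 A2 A3 hgen j1 j2 j3 hjd z hz a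
      ha2 ha13
    have hD := (genPos_iff d F1 F2 F3 _ _ _ A1 A2 A3).mp hgen
    have hgen' : GenPos3 d F1 F2 (flagMap d a F3) := by
      rw [genPos_iff d F1 F2 (flagMap d a F3) _ _ _ A1 A2 A3']
      intro k1 k2 k3 hk
      rw [hmain k1 k2 k3 hk]
      exact mul_ne_zero (pow_ne_zero _ hz) (hD k1 k2 k3 hk)
    have hD' := (genPos_iff d F1 F2 (flagMap d a F3) _ _ _ A1 A2 A4).mp hgen'
    obtain ⟨c, hc⟩ := adapted_change d (flagMap d a F3) _ _ A3' A4
    obtain ⟨C, hC⟩ : ∃ C : ℕ → ℂ, C = fun k => ∏ m ∈ Finset.range k, c m := ⟨_, rfl⟩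
    have key : ∀ k1 k2 k3, k1 + k2 + k3 = d →
        wedgeDet d k1 k2 (flagBasis d F1) (flagBasis d F2) (flagBasis d (flagMap d a F3)) =
        C k3 * (z ^ (min (k3 - j3) (j2 - k2)) *
          wedgeDet d k1 k2 (flagBasis d F1) (flagBasis d F2) (flagBasis d F3)) := by
      intro k1 k2 k3 hk
      rw [← hmain k1 k2 k3 hk, hC]
      exact wedge_third d k1 k2 k3 hk _ _ _ _ c
        fun m hm => Submodule.mem_sup_right (hc m (by omega))
    have hCne : ∀ k ≤ d, C k ≠ 0 := by
      intro k hk h0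
      apply hD' (d - k) 0 k (by omega)
      rw [key (d - k) 0 k (by omega), h0, zero_mul]
    have ratio : ∀ k1 k2 k3, 0 < k1 → 0 < k2 → 0 < k3 → k1 + k2 + k3 = d →
        tripleRatio d (k1, k2, k3) F1 F2 (flagMap d a F3) =
        (if k1 = j1 ∧ k2 = j2 then z else 1) * tripleRatio d (k1, k2, k3) F1 F2 F3 := by
      intro k1 k2 k3 p1 p2 p3 hk
      simp only [tripleRatio]
      rw [key (k1 + 1) k2 (k3 - 1) (by omega), key k1 (k2 - 1) (k3 + 1) (by omega),
        key (k1 - 1) (k2 + 1) k3 (by omega), key (k1 - 1) k2 (k3 + 1) (by omega),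
        key k1 (k2 + 1) (k3 - 1) (by omega), key (k1 + 1) (k2 - 1) k3 (by omega)]
      have n1 := hD (k1 - 1) k2 (k3 + 1) (by omega)
      have n2 := hD k1 (k2 + 1) (k3 - 1) (by omega)
      have n3 := hD (k1 + 1) (k2 - 1) k3 (by omega)
      have m1 := hCne (k3 - 1) (by omega)
      have m2 := hCne k3 (by omega)
      have m3 := hCne (k3 + 1) (by omega)
      have hpow : z ^ (min (k3 - 1 - j3) (j2 - k2)) * z ^ (min (k3 + 1 - j3) (j2 - (k2 - 1))) *
          z ^ (min (k3 - j3) (j2 - (k2 + 1))) = (if k1 = j1 ∧ k2 = j2 then z else 1) *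
          (z ^ (min (k3 + 1 - j3) (j2 - k2)) * z ^ (min (k3 - 1 - j3) (j2 - (k2 + 1))) *
          z ^ (min (k3 - j3) (j2 - (k2 - 1)))) := by
        have hite : (if k1 = j1 ∧ k2 = j2 then z else 1) =
            z ^ (if k1 = j1 ∧ k2 = j2 then 1 else 0) := by split_ifs <;> simp
        rw [hite]
        simp only [← pow_add]
        congr 1
        split_ifs <;> omega
      have q1 := pow_ne_zero (min (k3 + 1 - j3) (j2 - k2)) hz
      have q2 := pow_ne_zero (min (k3 - 1 - j3) (j2 - (k2 + 1))) hz
      have q3 := pow_ne_zero (min (k3 - j3) (j2 - (k2 - 1))) hz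
      generalize z ^ (min (k3 - 1 - j3) (j2 - k2)) = x1 at *
      generalize z ^ (min (k3 + 1 - j3) (j2 - (k2 - 1))) = x2 at *
      generalize z ^ (min (k3 - j3) (j2 - (k2 + 1))) = x3 at *
      generalize z ^ (min (k3 + 1 - j3) (j2 - k2)) = y1 at *
      generalize z ^ (min (k3 - 1 - j3) (j2 - (k2 + 1))) = y2 at *
      generalize z ^ (min (k3 - j3) (j2 - (k2 - 1))) = y3 at *
      generalize (if k1 = j1 ∧ k2 = j2 then z else 1) = e at *
      rw [← mul_div_assoc, div_eq_div_iff (by simp [n1, n2, n3, m1, m2, m3, q1, q2, q3])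
        (by simp [n1, n2, n3])]
      generalize wedgeDet d (k1 + 1) k2 _ _ _ = X1
      generalize wedgeDet d k1 (k2 - 1) _ _ _ = X2
      generalize wedgeDet d (k1 - 1) (k2 + 1) _ _ _ = X3
      generalize wedgeDet d (k1 - 1) k2 _ _ _ = Y1
      generalize wedgeDet d k1 (k2 + 1) _ _ _ = Y2
      generalize wedgeDet d (k1 + 1) (k2 - 1) _ _ _ = Y3
      linear_combination (C (k3 - 1) * C (k3 + 1) * C k3 * X1 * X2 * X3 * Y1 * Y2 * Y3) * hpow
    refine ⟨hgen', ?_, ?_⟩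
    · rw [ratio j1 j2 j3 hj1 hj2 hj3 hjd]; simp
    · rintro ⟨k1, k2, k3⟩ ⟨p1, p2, p3, hk⟩ hne
      simp only at p1 p2 p3 hk
      rw [ratio k1 k2 k3 p1 p2 p3 hk, if_neg, one_mul]
      rintro ⟨rfl, rfl⟩
      apply hne
      have : k3 = j3 := by omega
      rw [this]
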